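/- arXiv:1005.3586 — 2 statements merged into one kernel-verified Lean document; each statement's English description precedes it below -/
import Mathlib

section
/- Let a ∈ ℂ with a ≠ 0, and let (x,y) ∈ ℂ² with x ≠ 0, y ≠ 0, (y−a)(y−1/a) ≠ 0 and (y+a)(y+1/a) ≠ 0. Set x̄ = y and ȳ = −x(y−a)(y−1/a)/((y+a)(y+1/a)). Then F(x̄,ȳ) = −F(x,y), where F(u,v) = ((u²+1)(v²+1) + (a+1/a)(v−u)(uv+1))/(uv). In particular the parameter k of the invariant elliptic fibration is mapped to −k by the mapping. -/
open Complex

/-- The invariant rational function of the Case ii-1 mapping. -/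
noncomputable def Fii1 (a u v : ℂ) : ℂ :=
  ((u ^ 2 + 1) * (v ^ 2 + 1) + (a + 1 / a) * (v - u) * (u * v + 1)) / (u * v)

theorem stmt_0 (a x y : ℂ) (ha : a ≠ 0) (hx : x ≠ 0) (hy : y ≠ 0)
    (h1 : (y - a) * (y - 1 / a) ≠ 0) (h2 : (y + a) * (y + 1 / a) ≠ 0) :
    Fii1 a y (-x * ((y - a) * (y - 1 / a)) / ((y + a) * (y + 1 / a))) = -Fii1 a x y := by
  have hP : (y - a) * (y - 1 / a) = y ^ 2 - (a + 1 / a) * y + 1 := by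
    field_simp
    ring
  have hQ : (y + a) * (y + 1 / a) = y ^ 2 + (a + 1 / a) * y + 1 := by
    field_simp
    ring
  rw [hP] at h1 ⊢
  rw [hQ] at h2 ⊢
  unfold Fii1
  generalize a + 1 / a = s at *
  have e1 : ∀ v : ℂ, (y ^ 2 + 1) * (v ^ 2 + 1) + s * (v - y) * (y * v + 1)
      = (y ^ 2 + s * y + 1) * v ^ 2 - s * (y ^ 2 - 1) * v + (y ^ 2 - s * y + 1) := by
    intro v
    ring
  have e2 : (x ^ 2 + 1) * (y ^ 2 + 1) + s * (y - x) * (x * y + 1)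
      = (y ^ 2 - s * y + 1) * x ^ 2 + s * (y ^ 2 - 1) * x + (y ^ 2 + s * y + 1) := by
    ring
  rw [e1, e2]
  clear e1 e2 hP hQ
  generalize y ^ 2 - s * y + 1 = P at *
  generalize y ^ 2 + s * y + 1 = Q at *
  generalize s * (y ^ 2 - 1) = T at *
  field_simp
  ring
end

section
/- Let b ∈ ℂ with b ≠ 0 and let i denote the imaginary unit. Let (x,y) ∈ ℂ² be such that all denominators below are nonzero, and set x̄ = x(−ix(x+1) + y(bx+1))/(y(x(x−b) + iby(x−1))) and ȳ = x(x(x+1) + iby(x−1))/(b(x(x+1) − iy(x−1))). Define f₀(x,y) = x²y² and f₁(x,y) = (ix(x+1)² − i(x+i)(x²−1)y + b(x−1)²y²)·(−ix(y−1) + y(by−1)). Then f₁(x̄,ȳ)/f₀(x̄,ȳ) = −f₁(x,y)/f₀(x,y). In particular (f₁/f₀)² is a conserved quantity of the mapping, which therefore belongs to Case ii-2. -/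
open Complex

/-- First component of the Case ii-2 mapping. -/
noncomputable def phiX (b x y : ℂ) : ℂ :=
  x * (-Complex.I * x * (x + 1) + y * (b * x + 1)) /
    (y * (x * (x - b) + Complex.I * b * y * (x - 1)))

/-- Second component of the Case ii-2 mapping. -/
noncomputable def phiY (b x y : ℂ) : ℂ :=
  x * (x * (x + 1) + Complex.I * b * y * (x - 1)) /
    (b * (x * (x + 1) - Complex.I * y * (x - 1)))

/-- `f₀(x,y) = x²y²`. -/
noncomputable def f0ii2 (x y : ℂ) : ℂ := x ^ 2 * y ^ 2

/-- `f₁(x,y) = (ix(x+1)² − i(x+i)(x²−1)y + b(x−1)²y²)(−ix(y−1) + y(by−1))`. -/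
noncomputable def f1ii2 (b x y : ℂ) : ℂ :=
  (Complex.I * x * (x + 1) ^ 2 - Complex.I * (x + Complex.I) * (x ^ 2 - 1) * y +
      b * (x - 1) ^ 2 * y ^ 2) *
    (-Complex.I * x * (y - 1) + y * (b * y - 1))

lemma auxB (b x y J : ℂ) (hJ : J ^ 2 = -1) (hb : b ≠ 0) (hy : y ≠ 0)
    (h1 : x * (x - b) + J * b * y * (x - 1) ≠ 0)
    (h2 : x * (x + 1) - J * y * (x - 1) ≠ 0) :
    -J * (x * (-J * x * (x + 1) + y * (b * x + 1)) / (y * (x * (x - b) + J * b * y * (x - 1)))) *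
      (x * (x * (x + 1) + J * b * y * (x - 1)) / (b * (x * (x + 1) - J * y * (x - 1))) - 1) +
      x * (x * (x + 1) + J * b * y * (x - 1)) / (b * (x * (x + 1) - J * y * (x - 1))) *
      (b * (x * (x * (x + 1) + J * b * y * (x - 1)) / (b * (x * (x + 1) - J * y * (x - 1)))) - 1)
    = (-1) * x * (-J * x * (x + 1) + y * (b * x + 1)) *
      (J * x * (x + 1) ^ 2 - J * (x + J) * (x ^ 2 - 1) * y + b * (x - 1) ^ 2 * y ^ 2) /
      (y * b * (x * (x + 1) - J * y * (x - 1)) ^ 2) := by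
  generalize e1 : x * (x - b) + J * b * y * (x - 1) = d1 at *
  generalize e2 : x * (x + 1) - J * y * (x - 1) = d2 at *
  field_simp
  subst e1 e2
  clear h1 h2 hb hy
  grind

set_option maxRecDepth 100000 in
set_option maxHeartbeats 4000000 in
lemma auxA (b x y J : ℂ) (hJ : J ^ 2 = -1) (hb : b ≠ 0) (hy : y ≠ 0)
    (h1 : x * (x - b) + J * b * y * (x - 1) ≠ 0)
    (h2 : x * (x + 1) - J * y * (x - 1) ≠ 0) (X Y : ℂ)
    (hX : X = x * (-J * x * (x + 1) + y * (b * x + 1)) / (y * (x * (x - b) + J * b * y * (x - 1))))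
    (hY : Y = x * (x * (x + 1) + J * b * y * (x - 1)) / (b * (x * (x + 1) - J * y * (x - 1)))) :
    J * X * (X + 1) ^ 2 - J * (X + J) * (X ^ 2 - 1) * Y + b * (X - 1) ^ 2 * Y ^ 2
    = 1 * x * (-J * x * (x + 1) + y * (b * x + 1)) * (x * (x + 1) + J * b * y * (x - 1)) ^ 2 *
      (-J * x * (y - 1) + y * (b * y - 1)) /
      (y ^ 3 * b * (x * (x - b) + J * b * y * (x - 1)) ^ 2) := by
  subst hX hY
  generalize e1 : x * (x - b) + J * b * y * (x - 1) = d1 at *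
  generalize e2 : x * (x + 1) - J * y * (x - 1) = d2 at *
  field_simp
  subst e1 e2
  clear h1 h2 hb hy
  have J3 : J ^ 3 = -J := by linear_combination J * hJ
  have J4 : J ^ 4 = 1 := by linear_combination (J ^ 2 - 1) * hJ
  have J5 : J ^ 5 = J := by linear_combination J * J4
  have J6 : J ^ 6 = -1 := by linear_combination J ^ 2 * J4 + hJ
  have J7 : J ^ 7 = -J := by linear_combination J * J6
  have J8 : J ^ 8 = 1 := by linear_combination J ^ 4 * J4 + J4
  have J9 : J ^ 9 = J := by linear_combination J * J8
  ring_nf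
  simp only [hJ, J3, J4, J5, J6, J7, J8, J9]
  ring

theorem stmt_12 (b x y : ℂ) (hb : b ≠ 0)
    (hd1 : y * (x * (x - b) + Complex.I * b * y * (x - 1)) ≠ 0)
    (hd2 : b * (x * (x + 1) - Complex.I * y * (x - 1)) ≠ 0)
    (hf0 : f0ii2 x y ≠ 0)
    (hf0' : f0ii2 (phiX b x y) (phiY b x y) ≠ 0) :
    f1ii2 b (phiX b x y) (phiY b x y) / f0ii2 (phiX b x y) (phiY b x y) =
      -(f1ii2 b x y / f0ii2 x y) := by
  have hI : Complex.I ^ 2 = -1 := Complex.I_sq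
  obtain ⟨hy, h1⟩ := mul_ne_zero_iff.mp hd1
  obtain ⟨-, h2⟩ := mul_ne_zero_iff.mp hd2
  have hA := auxA b x y Complex.I hI hb hy h1 h2 _ _ rfl rfl
  have hB := auxB b x y Complex.I hI hb hy h1 h2
  unfold f0ii2 at *
  unfold f1ii2
  have hx : x ≠ 0 := by
    rintro rfl
    simp at hf0
  unfold phiX phiY at *
  rw [hA, hB]
  have hN1 : -Complex.I * x * (x + 1) + y * (b * x + 1) ≠ 0 := by
    intro h
    rw [h] at hf0'
    simp at hf0'
  have hN2 : x * (x + 1) + Complex.I * b * y * (x - 1) ≠ 0 := by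
    intro h
    rw [h] at hf0'
    simp at hf0'
  clear hA hB hf0' hf0 hd1 hd2
  generalize Complex.I * x * (x + 1) ^ 2 - Complex.I * (x + Complex.I) * (x ^ 2 - 1) * y +
      b * (x - 1) ^ 2 * y ^ 2 = A
  generalize -Complex.I * x * (y - 1) + y * (b * y - 1) = B
  generalize -Complex.I * x * (x + 1) + y * (b * x + 1) = N1 at *
  generalize x * (x + 1) + Complex.I * b * y * (x - 1) = N2 at *
  generalize x * (x - b) + Complex.I * b * y * (x - 1) = D1 at *
  generalize x * (x + 1) - Complex.I * y * (x - 1) = D2 at *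
  field_simp
  try ring
end
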